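/- Let λ1 denote the largest-eigenvalue function on Sⁿ, (X̄,Ȳ) ∈ gph ∂λ1, and Ū ∈ 𝕆ⁿ(X̄) ∩ 𝕆ⁿ(Ȳ). Let α¹ be the index set of the largest eigenvalue of X̄, μ := {i ∈ α¹ : λ_i(Ȳ) > 0} and ν := {i ∈ α¹ : λ_i(Ȳ) = 0}. Then: (a) H ∈ C(X̄+Ȳ; ∂λ1(X̄)) if and only if (diag(Ūᵀ H Ū))_i = λ1(Ūᵀ_{α¹} H Ū_{α¹}) for every i ∈ μ; (b) H ∈ aff(C(X̄+Ȳ; ∂λ1(X̄))) if and only if there exists ρ ∈ ℝ such that Ūᵀ_{α¹} H Ū_{α¹} = Diag(ρ I_{|μ|}, Ūᵀ_ν H Ū_ν) (block diagonal with respect to μ and ν); and (c) with ω := the union of α^l for l ≥ 2, Υ¹_{X̄}(Ȳ,H) = −2 ∑_{i∈μ} ∑_{j∈ω} [λ_i(Ȳ)/(λ_i(X̄) − λ_j(X̄))] ((Ūᵀ_μ H Ū_ω)_{ij})² ≤ 0 for all H ∈ Sⁿ. -/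

import Mathlib

open Matrix Filter Topology Set
open scoped Classical

noncomputable section

/-- The vector of eigenvalues of a symmetric matrix, in non-increasing order. -/
noncomputable def lamVec {n : ℕ} (X : Matrix (Fin n) (Fin n) ℝ) : Fin n → ℝ :=
  if h : X.IsHermitian then fun i => (h.eigenvalues ∘ Tuple.sort h.eigenvalues) i.rev else 0

/-- The set `𝕆ⁿ(X)` of orthogonal matrices giving an ordered eigenvalue decomposition of `X`. -/
def OSet {n : ℕ} (X : Matrix (Fin n) (Fin n) ℝ) : Set (Matrix (Fin n) (Fin n) ℝ) :=
  {U | Uᵀ * U = 1 ∧ X = U * Matrix.diagonal (lamVec X) * Uᵀ}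

/-- One-sided directional derivative of a scalar function. -/
noncomputable def dirDeriv {E : Type*} [AddCommMonoid E] [Module ℝ E] (f : E → ℝ) (x h : E) : ℝ :=
  limUnder (𝓝[>] (0:ℝ)) fun t => (f (x + t • h) - f x) / t

/-- Vector of one-sided directional derivatives of the ordered eigenvalues: `λ'(X;H)`. -/
noncomputable def lamDD {n : ℕ} (X H : Matrix (Fin n) (Fin n) ℝ) : Fin n → ℝ :=
  fun i => dirDeriv (fun Y => lamVec Y i) X H

/-- The max-of-affine convex piecewise affine function `φ(x) = max_i (⟨aⁱ,x⟩ - cᵢ)`. -/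
noncomputable def pwa {n p : ℕ} [NeZero p] (a : Fin p → Fin n → ℝ) (c : Fin p → ℝ)
    (x : Fin n → ℝ) : ℝ :=
  ⨆ i, (a i ⬝ᵥ x - c i)

/-- The active index set `ι(x̄)` of a max-of-affine function at `x̄`. -/
def iotaA {n p : ℕ} [NeZero p] (a : Fin p → Fin n → ℝ) (c : Fin p → ℝ)
    (x : Fin n → ℝ) : Set (Fin p) :=
  {i | a i ⬝ᵥ x - c i = pwa a c x}

/-- Frobenius inner product of two matrices. -/
def mip {n : ℕ} (A B : Matrix (Fin n) (Fin n) ℝ) : ℝ := (Aᵀ * B).trace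

/-- Convex subdifferential (over the space of symmetric matrices) of a real function. -/
def msubdiff {n : ℕ} (f : Matrix (Fin n) (Fin n) ℝ → ℝ) (X : Matrix (Fin n) (Fin n) ℝ) :
    Set (Matrix (Fin n) (Fin n) ℝ) :=
  {G | G.IsSymm ∧ ∀ Y : Matrix (Fin n) (Fin n) ℝ, Y.IsSymm → f X + mip G (Y - X) ≤ f Y}

/-- Moore–Penrose pseudo-inverse, via the four Penrose conditions. -/
noncomputable def mpInv {n : ℕ} (A : Matrix (Fin n) (Fin n) ℝ) : Matrix (Fin n) (Fin n) ℝ :=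
  Classical.epsilon fun B => A * B * A = A ∧ B * A * B = B ∧ (A * B)ᵀ = A * B ∧ (B * A)ᵀ = B * A

/-- The sigma-term function
`Υ_X(Y,H) = 2 ∑_l ⟨Λ(Y)_{αˡαˡ}, Uᵀ_{αˡ} H (X - v̄ₗ I)† H U_{αˡ}⟩` (written as a single sum
over eigenvalue indices). -/
noncomputable def Upsilon {n : ℕ} (X Y U H : Matrix (Fin n) (Fin n) ℝ) : ℝ :=
  2 * ∑ i, lamVec Y i *
    ((Uᵀ * H * mpInv (X - lamVec X i • (1 : Matrix (Fin n) (Fin n) ℝ)) * H * U) i i)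

/-- The largest eigenvalue of a symmetric matrix (over an arbitrary finite index type),
as the supremum of its eigenvalues. -/
noncomputable def maxEig {m : Type*} [Fintype m] (M : Matrix m m ℝ) : ℝ :=
  sSup {t : ℝ | ∃ v : m → ℝ, v ≠ 0 ∧ M.mulVec v = t • v}

/-- `c` is the top of the Rayleigh quotient of `M`. -/
def IsTopR {m : Type*} [Fintype m] (M : Matrix m m ℝ) (c : ℝ) : Prop :=
  (∀ v : m → ℝ, v ⬝ᵥ M *ᵥ v ≤ c * (v ⬝ᵥ v)) ∧ ∃ v : m → ℝ, v ⬝ᵥ v = 1 ∧ v ⬝ᵥ M *ᵥ v = c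

lemma isTop_conj {m : Type*} [Fintype m] [DecidableEq m] {M U : Matrix m m ℝ} {c : ℝ}
    (hU : Uᵀ * U = 1) (h : IsTopR M c) : IsTopR (Uᵀ * M * U) c := by
  have hU' : U * Uᵀ = 1 := mul_eq_one_comm.mp hU
  have key : ∀ v, v ⬝ᵥ (Uᵀ * M * U) *ᵥ v = (U *ᵥ v) ⬝ᵥ M *ᵥ (U *ᵥ v) := by
    intro v
    rw [← mulVec_mulVec, ← mulVec_mulVec, dotProduct_mulVec, vecMul_transpose]
  have key2 : ∀ v, (U *ᵥ v) ⬝ᵥ (U *ᵥ v) = v ⬝ᵥ v := by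
    intro v
    rw [dotProduct_mulVec, ← vecMul_transpose, vecMul_vecMul, hU, vecMul_one]
  refine ⟨fun v => ?_, ?_⟩
  · rw [key, ← key2]; exact h.1 _
  · obtain ⟨v, h1, h2⟩ := h.2
    have hv : U *ᵥ (Uᵀ *ᵥ v) = v := by rw [mulVec_mulVec, hU', one_mulVec]
    refine ⟨Uᵀ *ᵥ v, ?_, ?_⟩
    · rw [← key2, hv, h1]
    · rw [key, hv, h2]

lemma diag_quad {m : Type*} [Fintype m] [DecidableEq m] (d v : m → ℝ) :
    v ⬝ᵥ (Matrix.diagonal d) *ᵥ v = ∑ i, d i * v i ^ 2 := by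
  simp only [dotProduct, mulVec_diagonal]
  exact Finset.sum_congr rfl fun i _ => by ring

lemma dot_sq {m : Type*} [Fintype m] [DecidableEq m] (v : m → ℝ) : v ⬝ᵥ v = ∑ i, v i ^ 2 := by
  simp only [dotProduct]
  exact Finset.sum_congr rfl fun i _ => by ring

lemma isTop_diagonal {m : Type*} [Fintype m] [DecidableEq m] (d : m → ℝ) (i0 : m) (h : ∀ i, d i ≤ d i0) :
    IsTopR (Matrix.diagonal d) (d i0) := by
  refine ⟨fun v => ?_, Pi.single i0 1, ?_, ?_⟩
  · rw [diag_quad, dot_sq, Finset.mul_sum]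
    exact Finset.sum_le_sum fun i _ => mul_le_mul_of_nonneg_right (h i) (sq_nonneg _)
  · simp
  · simp

lemma isTop_eig {m : Type*} [Fintype m] [DecidableEq m] {M : Matrix m m ℝ} (hM : M.IsHermitian) (i0 : m)
    (h : ∀ i, hM.eigenvalues i ≤ hM.eigenvalues i0) : IsTopR M (hM.eigenvalues i0) := by
  have h1 := isTop_diagonal hM.eigenvalues i0 h
  have h2 := hM.spectral_theorem
  set U : Matrix m m ℝ := (hM.eigenvectorUnitary : Matrix m m ℝ) with hUdef
  have hs : star U = Uᵀ := by
    rw [star_eq_conjTranspose, conjTranspose_eq_transpose_of_trivial]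
  have hU : U * Uᵀ = 1 := by
    rw [← hs]; exact Unitary.coe_mul_star_self hM.eigenvectorUnitary
  have h3 : M = U * Matrix.diagonal hM.eigenvalues * Uᵀ := by
    rw [← hs]; simpa [Unitary.conjStarAlgAut_apply] using! h2
  have := isTop_conj (U := Uᵀ) (by rw [transpose_transpose]; exact hU) h1
  rw [transpose_transpose, ← h3] at this
  exact this

lemma symm_herm {m : Type*} {M : Matrix m m ℝ} (h : M.IsSymm) : M.IsHermitian := by
  rw [Matrix.IsHermitian, conjTranspose_eq_transpose_of_trivial]; exact h

lemma isTop_maxEig {m : Type*} [Fintype m] [DecidableEq m] [Nonempty m] {M : Matrix m m ℝ} (hM : M.IsSymm) :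
    IsTopR M (maxEig M) := by
  have hH := symm_herm hM
  obtain ⟨i0, hi0⟩ := Finite.exists_max hH.eigenvalues
  have ht := isTop_eig hH i0 hi0
  have hg : IsGreatest {t : ℝ | ∃ v : m → ℝ, v ≠ 0 ∧ M.mulVec v = t • v} (hH.eigenvalues i0) := by
    constructor
    · refine ⟨⇑(hH.eigenvectorBasis i0), ?_, hH.mulVec_eigenvectorBasis i0⟩
      intro h0
      have := hH.eigenvectorBasis.orthonormal.ne_zero i0
      apply this
      ext j
      exact congrFun h0 j
    · rintro t ⟨v, hv, hMv⟩
      have := ht.1 v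
      rw [hMv, dotProduct_smul, smul_eq_mul] at this
      have hpos : 0 < v ⬝ᵥ v := by
        rw [dot_sq]
        obtain ⟨j, hj⟩ := Function.ne_iff.mp hv
        exact Finset.sum_pos' (fun _ _ => sq_nonneg _) ⟨j, Finset.mem_univ _, by
          have : v j ≠ 0 := hj
          positivity⟩
      exact le_of_mul_le_mul_right this hpos
  rw [maxEig, hg.csSup_eq]
  exact ht

lemma isTop_lamVec {n : ℕ} [NeZero n] {X : Matrix (Fin n) (Fin n) ℝ} (hX : X.IsSymm) :
    IsTopR X (lamVec X 0) := by
  have hH := symm_herm hX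
  have : lamVec X 0 = hH.eigenvalues (Tuple.sort hH.eigenvalues (Fin.rev 0)) := by
    rw [lamVec, dif_pos hH]; rfl
  rw [this]
  apply isTop_eig
  intro i
  have hm := Tuple.monotone_sort hH.eigenvalues
  have hle : (Tuple.sort hH.eigenvalues).symm i ≤ Fin.rev 0 := by
    rw [Fin.le_def, Fin.val_rev]
    have := ((Tuple.sort hH.eigenvalues).symm i).2
    simp; omega
  simpa using hm hle

lemma isTop_diag_le {m : Type*} [Fintype m] [DecidableEq m] {M : Matrix m m ℝ} {c : ℝ} (h : IsTopR M c) (i : m) :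
    M i i ≤ c := by
  have := h.1 (Pi.single i 1)
  simpa using this

lemma conj_diag {n : ℕ} {U X : Matrix (Fin n) (Fin n) ℝ} {d : Fin n → ℝ} (hU : Uᵀ * U = 1)
    (hX : X = U * Matrix.diagonal d * Uᵀ) : Uᵀ * X * U = Matrix.diagonal d := by
  rw [hX]
  calc Uᵀ * (U * diagonal d * Uᵀ) * U = (Uᵀ * U) * diagonal d * (Uᵀ * U) := by
        simp only [Matrix.mul_assoc]
    _ = _ := by rw [hU]; simp

lemma mip_eq {n : ℕ} {U Y : Matrix (Fin n) (Fin n) ℝ} {y : Fin n → ℝ}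
    (hY : Y = U * Matrix.diagonal y * Uᵀ) (H : Matrix (Fin n) (Fin n) ℝ) :
    mip Y H = ∑ i, y i * (Uᵀ * H * U) i i := by
  have h1 : Yᵀ = U * Matrix.diagonal y * Uᵀ := by
    rw [hY]; simp [Matrix.transpose_mul, Matrix.mul_assoc]
  rw [mip, h1]
  have : U * diagonal y * Uᵀ * H = U * (diagonal y * (Uᵀ * H)) := by simp only [Matrix.mul_assoc]
  rw [this, Matrix.trace_mul_comm, Matrix.mul_assoc]
  simp [Matrix.trace, Matrix.diagonal_mul]

lemma bilin_bound {m : Type*} [Fintype m] [DecidableEq m] (M : Matrix m m ℝ) {K s : ℝ}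
    (hK : ∑ i, ∑ j, |M i j| ≤ K) (hs : 0 < s) (x y : m → ℝ) :
    2 * (x ⬝ᵥ M *ᵥ y) ≤ K * (s * (x ⬝ᵥ x) + (y ⬝ᵥ y) / s) := by
  have hx : ∀ i, x i ^ 2 ≤ x ⬝ᵥ x := fun i => by
    rw [dot_sq]
    exact Finset.single_le_sum (f := fun i => x i ^ 2) (fun _ _ => sq_nonneg _) (Finset.mem_univ i)
  have hy : ∀ i, y i ^ 2 ≤ y ⬝ᵥ y := fun i => by
    rw [dot_sq]
    exact Finset.single_le_sum (f := fun i => y i ^ 2) (fun _ _ => sq_nonneg _) (Finset.mem_univ i)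
  set R := s * (x ⬝ᵥ x) + (y ⬝ᵥ y) / s with hR
  have hterm : ∀ i j, 2 * (x i * (M i j * y j)) ≤ |M i j| * R := by
    intro i j
    have h1 : |2 * (x i * y j)| ≤ R := by
      have e1 : s * x i ^ 2 + y j ^ 2 / s ≤ R := by
        rw [hR]; gcongr
        · exact hx i
        · exact hy j
      refine le_trans ?_ e1
      have e2 : s * x i ^ 2 + y j ^ 2 / s - 2 * (x i * y j) = (s * x i - y j) ^ 2 / s := by
        field_simp; ring
      have e3 : s * x i ^ 2 + y j ^ 2 / s + 2 * (x i * y j) = (s * x i + y j) ^ 2 / s := by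
        field_simp; ring
      have e4 : 0 ≤ (s * x i - y j) ^ 2 / s := by positivity
      have e5 : 0 ≤ (s * x i + y j) ^ 2 / s := by positivity
      rw [abs_le]; constructor <;> linarith
    calc 2 * (x i * (M i j * y j)) = M i j * (2 * (x i * y j)) := by ring
      _ ≤ |M i j * (2 * (x i * y j))| := le_abs_self _
      _ = |M i j| * |2 * (x i * y j)| := abs_mul _ _
      _ ≤ _ := by gcongr
  have hR0 : 0 ≤ R := by
    have a1 : 0 ≤ x ⬝ᵥ x := by rw [dot_sq]; positivity
    have a2 : 0 ≤ y ⬝ᵥ y := by rw [dot_sq]; positivity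
    positivity
  calc 2 * (x ⬝ᵥ M *ᵥ y) = ∑ i, ∑ j, 2 * (x i * (M i j * y j)) := by
        simp only [dotProduct, mulVec, Finset.mul_sum]
    _ ≤ ∑ i, ∑ j, |M i j| * R := Finset.sum_le_sum fun i _ => Finset.sum_le_sum fun j _ => hterm i j
    _ = (∑ i, ∑ j, |M i j|) * R := by simp only [Finset.sum_mul]
    _ ≤ _ := by gcongr

lemma sub_dot {n : ℕ} (P : Fin n → Prop) [DecidablePred P] (M : Matrix (Fin n) (Fin n) ℝ) (a : Fin n → ℝ)
    (ha : ∀ i, ¬ P i → a i = 0) :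
    (a ⬝ᵥ M *ᵥ a = (fun z : {i // P i} => a z.1) ⬝ᵥ
      (Matrix.of fun z z' : {i // P i} => M z.1 z'.1) *ᵥ (fun z : {i // P i} => a z.1)) ∧
    a ⬝ᵥ a = (fun z : {i // P i} => a z.1) ⬝ᵥ (fun z : {i // P i} => a z.1) := by
  have hsum : ∀ f : Fin n → ℝ, (∀ i, ¬ P i → f i = 0) → ∑ i, f i = ∑ z : {i // P i}, f z.1 := by
    intro f hf
    rw [← Finset.sum_subtype (Finset.univ.filter P) (by simp) f]
    refine (Finset.sum_subset (Finset.subset_univ _) fun i _ hi => hf i ?_).symm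
    simpa using hi
  constructor
  · simp only [dotProduct, mulVec, Matrix.of_apply]
    rw [hsum _ (fun i hi => by rw [ha i hi, zero_mul])]
    refine Finset.sum_congr rfl fun z _ => ?_
    rw [hsum _ (fun i hi => by rw [ha i hi, mul_zero])]
  · simp only [dotProduct]
    rw [hsum _ (fun i hi => by rw [ha i hi, zero_mul])]

lemma upper_bound {n : ℕ} (lam : Fin n → ℝ) (l0 c : ℝ) (M : Matrix (Fin n) (Fin n) ℝ)
    (hM : M.IsSymm) (hl : ∀ i, lam i ≤ l0)
    (hc : ∀ a : Fin n → ℝ, (∀ i, ¬ lam i = l0 → a i = 0) → a ⬝ᵥ M *ᵥ a ≤ c * (a ⬝ᵥ a)) :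
    ∃ D : ℝ, ∀ᶠ t in 𝓝[>] (0:ℝ), ∀ v : Fin n → ℝ,
      v ⬝ᵥ (Matrix.diagonal lam + t • M) *ᵥ v ≤ (l0 + t * c + D * t ^ 2) * (v ⬝ᵥ v) := by
  obtain ⟨δ, hδ, hgap⟩ : ∃ δ > 0, ∀ i, ¬ lam i = l0 → lam i ≤ l0 - δ := by
    rcases isEmpty_or_nonempty (Fin n) with h | h
    · exact ⟨1, one_pos, fun i => h.elim i⟩
    obtain ⟨i0, hi0⟩ := Finite.exists_min (fun i => if lam i = l0 then 1 else l0 - lam i)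
    refine ⟨if lam i0 = l0 then 1 else l0 - lam i0, ?_, fun i hi => ?_⟩
    · split_ifs with h
      · exact one_pos
      · have := lt_of_le_of_ne (hl i0) h
        simpa using this
    · have := hi0 i
      simp only [hi, if_false] at this
      linarith
  set K := ∑ i, ∑ j, |M i j| + 1 with hKdef
  have hK0 : 0 < K := by positivity
  have hK : ∑ i, ∑ j, |M i j| ≤ K := by linarith
  set s := 2 * K / δ with hs
  have hs0 : 0 < s := by positivity
  have hKs : K / s = δ / 2 := by rw [hs]; field_simp
  refine ⟨K * s, ?_⟩
  have hev : ∀ᶠ t in 𝓝[>] (0:ℝ), t * (K + |c|) ≤ δ / 2 := by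
    have : Tendsto (fun t : ℝ => t * (K + |c|)) (𝓝[>] 0) (𝓝 (0 * (K + |c|))) :=
      ((continuous_id.mul continuous_const).tendsto 0).mono_left nhdsWithin_le_nhds
    rw [zero_mul] at this
    exact this.eventually (eventually_le_nhds (by positivity))
  filter_upwards [hev, self_mem_nhdsWithin] with t ht ht0 v
  have ht0 : 0 < t := ht0
  set a : Fin n → ℝ := fun i => if lam i = l0 then v i else 0 with ha
  set b : Fin n → ℝ := fun i => if lam i = l0 then 0 else v i with hb
  have hvab : v = a + b := by
    ext i; simp only [ha, hb, Pi.add_apply]; split_ifs <;> simp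
  have hvv : v ⬝ᵥ v = a ⬝ᵥ a + b ⬝ᵥ b := by
    simp only [dot_sq, ← Finset.sum_add_distrib]
    refine Finset.sum_congr rfl fun i _ => ?_
    simp only [ha, hb]; split_ifs <;> simp
  have hd : v ⬝ᵥ (Matrix.diagonal lam) *ᵥ v ≤ l0 * (a ⬝ᵥ a) + (l0 - δ) * (b ⬝ᵥ b) := by
    rw [diag_quad]
    simp only [dot_sq, Finset.mul_sum, ← Finset.sum_add_distrib]
    refine Finset.sum_le_sum fun i _ => ?_
    simp only [ha, hb]; split_ifs with h
    · simp [h]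
    · have := mul_le_mul_of_nonneg_right (hgap i h) (sq_nonneg (v i))
      simpa using this
  have hba : b ⬝ᵥ M *ᵥ a = a ⬝ᵥ M *ᵥ b := by
    rw [dotProduct_mulVec, ← mulVec_transpose, hM.eq, dotProduct_comm]
  have hMv : v ⬝ᵥ M *ᵥ v = a ⬝ᵥ M *ᵥ a + 2 * (a ⬝ᵥ M *ᵥ b) + b ⬝ᵥ M *ᵥ b := by
    rw [hvab, mulVec_add, add_dotProduct, dotProduct_add, dotProduct_add, hba]; ring
  have h1 := hc a (fun i hi => by simp [ha, hi])
  have h2 := bilin_bound M hK (mul_pos ht0 hs0) a b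
  have h3 := bilin_bound M hK one_pos b b
  have hA : 0 ≤ a ⬝ᵥ a := by rw [dot_sq]; positivity
  have hB : 0 ≤ b ⬝ᵥ b := by rw [dot_sq]; positivity
  rw [add_mulVec, dotProduct_add, smul_mulVec, dotProduct_smul, smul_eq_mul, hMv, hvv]
  generalize a ⬝ᵥ a = A at *
  generalize b ⬝ᵥ b = B at *
  have h2' : t * (2 * (a ⬝ᵥ M *ᵥ b)) ≤ K * s * t ^ 2 * A + δ / 2 * B := by
    have := mul_le_mul_of_nonneg_left h2 ht0.le
    refine this.trans (le_of_eq ?_)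
    rw [← hKs]; field_simp
  have h3' : t * (b ⬝ᵥ M *ᵥ b) ≤ t * (K * B) := by
    apply mul_le_mul_of_nonneg_left _ ht0.le
    linarith
  have h1' := mul_le_mul_of_nonneg_left h1 ht0.le
  have h4 : t * (K + |c|) * B ≤ δ / 2 * B := mul_le_mul_of_nonneg_right ht hB
  have h5 : 0 ≤ t * B * (c + |c|) := by
    have := neg_abs_le c
    have : 0 ≤ c + |c| := by linarith
    positivity
  have h6 : 0 ≤ K * s * t ^ 2 * B := by positivity
  nlinarith

lemma block_le {n : ℕ} (P : Fin n → Prop) [DecidablePred P] (M : Matrix (Fin n) (Fin n) ℝ) {c : ℝ}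
    (h : IsTopR (Matrix.of fun z z' : {i // P i} => M z.1 z'.1) c) (a : Fin n → ℝ)
    (ha : ∀ i, ¬ P i → a i = 0) : a ⬝ᵥ M *ᵥ a ≤ c * (a ⬝ᵥ a) := by
  obtain ⟨h1, h2⟩ := sub_dot P M a ha
  rw [h1, h2]; exact h.1 _

lemma block_ex {n : ℕ} (P : Fin n → Prop) [DecidablePred P] (M : Matrix (Fin n) (Fin n) ℝ) {c : ℝ}
    (h : IsTopR (Matrix.of fun z z' : {i // P i} => M z.1 z'.1) c) :
    ∃ a : Fin n → ℝ, (∀ i, ¬ P i → a i = 0) ∧ a ⬝ᵥ a = 1 ∧ a ⬝ᵥ M *ᵥ a = c := by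
  obtain ⟨w, hw1, hw2⟩ := h.2
  let a : Fin n → ℝ := fun i => if hi : P i then w ⟨i, hi⟩ else 0
  have ha : ∀ i, ¬ P i → a i = 0 := fun i hi => by simp [a, hi]
  have haw : (fun z : {i // P i} => a z.1) = w := by
    ext z; simp [a, z.2]
  obtain ⟨h1, h2⟩ := sub_dot P M a ha
  rw [haw] at h1 h2
  exact ⟨a, ha, h2.trans hw1, h1.trans hw2⟩

lemma symm_conj {n : ℕ} {H : Matrix (Fin n) (Fin n) ℝ} (U : Matrix (Fin n) (Fin n) ℝ)
    (hH : H.IsSymm) : (Uᵀ * H * U).IsSymm := by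
  rw [Matrix.IsSymm, transpose_mul, transpose_mul, transpose_transpose, hH.eq, Matrix.mul_assoc]

lemma dirDeriv_eq {n : ℕ} [NeZero n] {X U H : Matrix (Fin n) (Fin n) ℝ} (hX : X.IsSymm)
    (hH : H.IsSymm) (hU : Uᵀ * U = 1) (hd : X = U * Matrix.diagonal (lamVec X) * Uᵀ) :
    dirDeriv (fun X => lamVec X 0) X H =
      maxEig (Matrix.of fun z z' : {i : Fin n // lamVec X i = lamVec X 0} =>
            (Uᵀ * H * U) z.1 z'.1) := by
  have hMs := symm_conj U hH
  set M := Uᵀ * H * U with hM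
  have hXd := conj_diag hU hd
  have hl : ∀ i, lamVec X i ≤ lamVec X 0 := by
    intro i
    have := isTop_diag_le (isTop_conj hU (isTop_lamVec hX)) i
    rw [hXd] at this; simpa using this
  have : Nonempty {i : Fin n // lamVec X i = lamVec X 0} := ⟨⟨0, rfl⟩⟩
  have htop : IsTopR (Matrix.of fun z z' : {i : Fin n // lamVec X i = lamVec X 0} => M z.1 z'.1)
      (maxEig (Matrix.of fun z z' : {i : Fin n // lamVec X i = lamVec X 0} => M z.1 z'.1)) := by
    apply isTop_maxEig
    ext z z'
    exact hMs.apply _ _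
  set c := maxEig (Matrix.of fun z z' : {i : Fin n // lamVec X i = lamVec X 0} => M z.1 z'.1)
  obtain ⟨D, hD⟩ := upper_bound (lamVec X) (lamVec X 0) c M hMs hl (block_le _ M htop)
  obtain ⟨a, ha0, ha1, ha2⟩ := block_ex _ M htop
  have hT : ∀ t : ℝ, IsTopR (Matrix.diagonal (lamVec X) + t • M) (lamVec (X + t • H) 0) := by
    intro t
    have hs : (X + t • H).IsSymm := hX.add (hH.smul t)
    have := isTop_conj hU (isTop_lamVec hs)
    have e : Uᵀ * (X + t • H) * U = Matrix.diagonal (lamVec X) + t • M := by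
      rw [Matrix.mul_add, Matrix.add_mul, hXd, hM]; simp
    rwa [e] at this
  unfold dirDeriv
  apply Tendsto.limUnder_eq
  have hlim : Tendsto (fun t : ℝ => c + D * t) (𝓝[>] 0) (𝓝 c) := by
    have : Tendsto (fun t : ℝ => c + D * t) (𝓝 0) (𝓝 (c + D * 0)) :=
      (continuous_const.add (continuous_const.mul continuous_id)).tendsto 0
    rw [mul_zero, add_zero] at this
    exact this.mono_left nhdsWithin_le_nhds
  refine tendsto_of_tendsto_of_tendsto_of_le_of_le' tendsto_const_nhds hlim ?_ ?_
  · filter_upwards [self_mem_nhdsWithin] with t ht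
    have ht : 0 < t := ht
    rw [le_div_iff₀ ht]
    have h1 := (hT t).1 a
    rw [add_mulVec, dotProduct_add, smul_mulVec, dotProduct_smul, smul_eq_mul, ha1, ha2,
      diag_quad] at h1
    have : ∑ i, lamVec X i * a i ^ 2 = lamVec X 0 := by
      have e : ∑ i, lamVec X i * a i ^ 2 = ∑ i, lamVec X 0 * a i ^ 2 := by
        refine Finset.sum_congr rfl fun i _ => ?_
        by_cases hi : lamVec X i = lamVec X 0
        · rw [hi]
        · rw [ha0 i hi]; simp
      rw [e, ← Finset.mul_sum, ← dot_sq, ha1, mul_one]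
    linarith
  · filter_upwards [self_mem_nhdsWithin, hD] with t ht hD
    have ht : 0 < t := ht
    rw [div_le_iff₀ ht]
    obtain ⟨v, hv1, hv2⟩ := (hT t).2
    have := hD v
    rw [hv1, hv2] at this
    nlinarith

lemma subdiff_facts {n : ℕ} [NeZero n] {X Y U : Matrix (Fin n) (Fin n) ℝ} (hX : X.IsSymm)
    (hY : Y ∈ msubdiff (fun X => lamVec X 0) X) (hU : Uᵀ * U = 1)
    (hd : X = U * Matrix.diagonal (lamVec X) * Uᵀ)
    (hy : Y = U * Matrix.diagonal (lamVec Y) * Uᵀ) :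
    (∀ i, lamVec X i ≤ lamVec X 0) ∧ (∀ i, 0 ≤ lamVec Y i) ∧ (∑ i, lamVec Y i = 1) ∧
      ∀ i, lamVec X i ≠ lamVec X 0 → lamVec Y i = 0 := by
  have hXd := conj_diag hU hd
  have hl : ∀ i, lamVec X i ≤ lamVec X 0 := by
    intro i
    have := isTop_diag_le (isTop_conj hU (isTop_lamVec hX)) i
    rw [hXd] at this; simpa using this
  have key : ∀ (d : Fin n → ℝ) (b : ℝ), (∀ i, lamVec X i + d i ≤ b) →
      lamVec X 0 + ∑ i, lamVec Y i * d i ≤ b := by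
    intro d b hb
    have hds : (U * Matrix.diagonal d * Uᵀ).IsSymm := by
      rw [Matrix.IsSymm, transpose_mul, transpose_mul, transpose_transpose, diagonal_transpose,
        Matrix.mul_assoc]
    have hs : (X + U * Matrix.diagonal d * Uᵀ).IsSymm := hX.add hds
    have h1 := hY.2 _ hs
    have hc := conj_diag (X := U * Matrix.diagonal d * Uᵀ) hU rfl
    rw [add_sub_cancel_left, mip_eq hy, hc] at h1
    simp only [diagonal_apply_eq] at h1
    refine h1.trans ?_
    have h2 := isTop_conj hU (isTop_lamVec hs)
    rw [Matrix.mul_add, Matrix.add_mul, hXd, hc, diagonal_add] at h2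
    obtain ⟨v, hv1, hv2⟩ := h2.2
    rw [← hv2, diag_quad]
    calc _ ≤ ∑ i, b * v i ^ 2 :=
          Finset.sum_le_sum fun i _ => mul_le_mul_of_nonneg_right (hb i) (sq_nonneg _)
      _ = b := by rw [← Finset.mul_sum, ← dot_sq, hv1, mul_one]
  have hnn : ∀ i, 0 ≤ lamVec Y i := by
    intro i
    have := key (fun j => if j = i then -1 else 0) (lamVec X 0) (fun j => by
      have := hl j
      split_ifs <;> linarith)
    simp at this
    exact this
  refine ⟨hl, hnn, ?_, ?_⟩
  · have h1 := key (fun _ => 1) (lamVec X 0 + 1) (fun j => by linarith [hl j])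
    have h2 := key (fun _ => -1) (lamVec X 0 - 1) (fun j => by linarith [hl j])
    simp at h1 h2
    linarith
  · intro i hi
    have hlt : lamVec X i < lamVec X 0 := lt_of_le_of_ne (hl i) hi
    have := key (fun j => if j = i then lamVec X 0 - lamVec X i else 0) (lamVec X 0) (fun j => by
      have := hl j
      split_ifs with h
      · rw [h]; linarith
      · linarith)
    simp at this
    nlinarith [hnn i]

lemma mp_unique {n : ℕ} {A B C : Matrix (Fin n) (Fin n) ℝ}
    (hB : A * B * A = A ∧ B * A * B = B ∧ (A * B)ᵀ = A * B ∧ (B * A)ᵀ = B * A)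
    (hC : A * C * A = A ∧ C * A * C = C ∧ (A * C)ᵀ = A * C ∧ (C * A)ᵀ = C * A) : B = C := by
  obtain ⟨b1, b2, b3, b4⟩ := hB
  obtain ⟨c1, c2, c3, c4⟩ := hC
  have e1 : A * B = A * C := by
    calc A * B = (A * B)ᵀ := b3.symm
      _ = ((A * C) * (A * B))ᵀ := by
          rw [← Matrix.mul_assoc (A * C), c1]
      _ = (A * B)ᵀ * (A * C)ᵀ := by rw [transpose_mul]
      _ = (A * B) * (A * C) := by rw [b3, c3]
      _ = A * C := by rw [← Matrix.mul_assoc, b1]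
  have e2 : B * A = C * A := by
    calc B * A = (B * A)ᵀ := b4.symm
      _ = ((B * A) * (C * A))ᵀ := by
          rw [Matrix.mul_assoc B, ← Matrix.mul_assoc A, c1]
      _ = (C * A)ᵀ * (B * A)ᵀ := by rw [transpose_mul]
      _ = (C * A) * (B * A) := by rw [b4, c4]
      _ = C * A := by rw [Matrix.mul_assoc C, ← Matrix.mul_assoc A, b1]
  calc B = B * A * B := b2.symm
    _ = C * A * C := by rw [e2, Matrix.mul_assoc, e1, ← Matrix.mul_assoc]
    _ = C := c2

lemma mpInv_eq {n : ℕ} {A U : Matrix (Fin n) (Fin n) ℝ} {d : Fin n → ℝ} (hU : Uᵀ * U = 1)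
    (hA : A = U * Matrix.diagonal d * Uᵀ) :
    mpInv A = U * Matrix.diagonal (fun i => (d i)⁻¹) * Uᵀ := by
  have hmul : ∀ p q : Fin n → ℝ, (U * Matrix.diagonal p * Uᵀ) * (U * Matrix.diagonal q * Uᵀ) =
      U * Matrix.diagonal (fun i => p i * q i) * Uᵀ := by
    intro p q
    calc _ = U * Matrix.diagonal p * (Uᵀ * U) * Matrix.diagonal q * Uᵀ := by
          simp only [Matrix.mul_assoc]
      _ = _ := by rw [hU, Matrix.mul_one, Matrix.mul_assoc U, diagonal_mul_diagonal]
  have htr : ∀ p : Fin n → ℝ,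
      (U * Matrix.diagonal p * Uᵀ)ᵀ = U * Matrix.diagonal p * Uᵀ := by
    intro p
    rw [transpose_mul, transpose_mul, transpose_transpose, diagonal_transpose,
        Matrix.mul_assoc]
  have hC : A * (U * Matrix.diagonal (fun i => (d i)⁻¹) * Uᵀ) * A = A ∧
      (U * Matrix.diagonal (fun i => (d i)⁻¹) * Uᵀ) * A *
        (U * Matrix.diagonal (fun i => (d i)⁻¹) * Uᵀ) =
        (U * Matrix.diagonal (fun i => (d i)⁻¹) * Uᵀ) ∧
      (A * (U * Matrix.diagonal (fun i => (d i)⁻¹) * Uᵀ))ᵀ =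
        A * (U * Matrix.diagonal (fun i => (d i)⁻¹) * Uᵀ) ∧
      ((U * Matrix.diagonal (fun i => (d i)⁻¹) * Uᵀ) * A)ᵀ =
        (U * Matrix.diagonal (fun i => (d i)⁻¹) * Uᵀ) * A := by
    rw [hA]
    simp only [hmul, htr, and_true]
    constructor
    · congr 3; ext i; exact mul_inv_mul_cancel _
    · have : (fun i => (d i)⁻¹ * d i * (d i)⁻¹) = fun i => (d i)⁻¹ := by
        ext i
        by_cases h : d i = 0
        · simp [h]
        · field_simp
      rw [this]
  have := Classical.epsilon_spec (p := fun B => A * B * A = A ∧ B * A * B = B ∧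
    (A * B)ᵀ = A * B ∧ (B * A)ᵀ = B * A) ⟨_, hC⟩
  exact mp_unique this hC

lemma upsilon_eq {n : ℕ} {X Y U H : Matrix (Fin n) (Fin n) ℝ} (hH : H.IsSymm) (hU : Uᵀ * U = 1)
    (hd : X = U * Matrix.diagonal (lamVec X) * Uᵀ) :
    Upsilon X Y U H = 2 * ∑ i, lamVec Y i *
      ∑ j, (lamVec X j - lamVec X i)⁻¹ * ((Uᵀ * H * U) i j) ^ 2 := by
  unfold Upsilon
  congr 1
  refine Finset.sum_congr rfl fun i _ => ?_
  congr 1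
  have hA : X - lamVec X i • (1 : Matrix (Fin n) (Fin n) ℝ) =
      U * Matrix.diagonal (fun j => lamVec X j - lamVec X i) * Uᵀ := by
    have hU' : U * Uᵀ = 1 := mul_eq_one_comm.mp hU
    have : Matrix.diagonal (fun j => lamVec X j - lamVec X i) =
        Matrix.diagonal (lamVec X) - lamVec X i • (1 : Matrix (Fin n) (Fin n) ℝ) := by
      rw [smul_one_eq_diagonal, diagonal_sub]
    rw [this, Matrix.mul_sub, Matrix.sub_mul, ← hd]
    simp [hU']
  rw [mpInv_eq hU hA]
  have hMs := symm_conj U hH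
  have e : Uᵀ * H * (U * Matrix.diagonal (fun j => (lamVec X j - lamVec X i)⁻¹) * Uᵀ) * H * U =
      (Uᵀ * H * U) * (Matrix.diagonal (fun j => (lamVec X j - lamVec X i)⁻¹) * (Uᵀ * H * U)) := by
    simp only [Matrix.mul_assoc]
  rw [e]
  generalize Uᵀ * H * U = M at *
  rw [Matrix.mul_apply]
  refine Finset.sum_congr rfl fun j _ => ?_
  rw [Matrix.diagonal_mul, hMs.apply i j]
  ring

/-- Section 5, largest-eigenvalue example.  Let `λ₁` be the
largest-eigenvalue function, `Ȳ ∈ ∂λ₁(X̄)`, `Ū ∈ 𝕆ⁿ(X̄) ∩ 𝕆ⁿ(Ȳ)`, `α¹` the block of the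
largest eigenvalue of `X̄`, `μ = {i ∈ α¹ : λᵢ(Ȳ) > 0}`, `ν = {i ∈ α¹ : λᵢ(Ȳ) = 0}`.
Then: (a) `H ∈ C(X̄+Ȳ;∂λ₁(X̄))` iff `(ŪᵀHŪ)ᵢᵢ = λ₁(Ūᵀ_{α¹} H Ū_{α¹})` for all `i ∈ μ`;
(b) `H` lies in the affine hull of the critical cone iff `Ūᵀ_{α¹} H Ū_{α¹}` is
`Diag(ρ I_{|μ|}, Ūᵀ_ν H Ū_ν)` for some `ρ`; and (c) the sigma term satisfies the stated
formula and is nonpositive. -/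
theorem stmt18 {n : ℕ} [NeZero n]
    (lam1 : Matrix (Fin n) (Fin n) ℝ → ℝ)
    (hlam1 : lam1 = fun X => lamVec X 0)
    (Xb : Matrix (Fin n) (Fin n) ℝ) (hXb : Xb.IsSymm)
    (Yb : Matrix (Fin n) (Fin n) ℝ) (hYb : Yb ∈ msubdiff lam1 Xb)
    (Ub : Matrix (Fin n) (Fin n) ℝ) (hUb : Ub ∈ OSet Xb ∩ OSet Yb)
    (mu nu : Set (Fin n))
    (hmu : mu = {i | lamVec Xb i = lamVec Xb 0 ∧ 0 < lamVec Yb i})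
    (hnu : nu = {i | lamVec Xb i = lamVec Xb 0 ∧ lamVec Yb i = 0}) :
    (∀ H : Matrix (Fin n) (Fin n) ℝ, H.IsSymm →
      (dirDeriv lam1 Xb H = mip Yb H ↔
        ∀ i ∈ mu, (Ubᵀ * H * Ub) i i =
          maxEig (Matrix.of fun z z' : {i : Fin n // lamVec Xb i = lamVec Xb 0} =>
            (Ubᵀ * H * Ub) z.1 z'.1))) ∧
    (∀ H : Matrix (Fin n) (Fin n) ℝ, H.IsSymm →
      (H ∈ affineSpan ℝ {H' : Matrix (Fin n) (Fin n) ℝ |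
          H'.IsSymm ∧ dirDeriv lam1 Xb H' = mip Yb H'} ↔
        ∃ ρ : ℝ,
          (∀ i ∈ mu, ∀ j ∈ mu, (Ubᵀ * H * Ub) i j = if i = j then ρ else 0) ∧
          (∀ i ∈ mu, ∀ j ∈ nu, (Ubᵀ * H * Ub) i j = 0 ∧ (Ubᵀ * H * Ub) j i = 0))) ∧
    (∀ H : Matrix (Fin n) (Fin n) ℝ, H.IsSymm →
      Upsilon Xb Yb Ub H =
        -2 * ∑ i : Fin n, ∑ j : Fin n,
          (if i ∈ mu ∧ lamVec Xb j ≠ lamVec Xb 0 then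
            lamVec Yb i / (lamVec Xb i - lamVec Xb j) * ((Ubᵀ * H * Ub) i j)^2
          else 0) ∧
      Upsilon Xb Yb Ub H ≤ 0) := by
  subst hlam1
  obtain ⟨⟨hU, hd⟩, -, hy⟩ := hUb
  obtain ⟨hl, hnn, hsum, hzero⟩ := subdiff_facts hXb hYb hU hd hy
  have hne : Nonempty {i : Fin n // lamVec Xb i = lamVec Xb 0} := ⟨⟨0, rfl⟩⟩
  have htop : ∀ H : Matrix (Fin n) (Fin n) ℝ, H.IsSymm →
      IsTopR (Matrix.of fun z z' : {i : Fin n // lamVec Xb i = lamVec Xb 0} =>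
            (Ubᵀ * H * Ub) z.1 z'.1)
        (maxEig (Matrix.of fun z z' : {i : Fin n // lamVec Xb i = lamVec Xb 0} =>
            (Ubᵀ * H * Ub) z.1 z'.1)) := by
    intro H hH
    apply isTop_maxEig
    ext z z'
    exact (symm_conj Ub hH).apply _ _
  have hA : ∀ H : Matrix (Fin n) (Fin n) ℝ, H.IsSymm →
      (dirDeriv (fun X => lamVec X 0) Xb H = mip Yb H ↔
        ∀ i ∈ mu, (Ubᵀ * H * Ub) i i =
          maxEig (Matrix.of fun z z' : {i : Fin n // lamVec Xb i = lamVec Xb 0} =>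
            (Ubᵀ * H * Ub) z.1 z'.1)) := by
    intro H hH
    rw [dirDeriv_eq hXb hH hU hd, mip_eq hy]
    have ht := htop H hH
    set c := maxEig (Matrix.of fun z z' : {i : Fin n // lamVec Xb i = lamVec Xb 0} =>
            (Ubᵀ * H * Ub) z.1 z'.1)
    have hle : ∀ i, lamVec Xb i = lamVec Xb 0 → (Ubᵀ * H * Ub) i i ≤ c :=
      fun i hi => isTop_diag_le ht ⟨i, hi⟩
    have hnn2 : ∀ i ∈ Finset.univ, 0 ≤ lamVec Yb i * (c - (Ubᵀ * H * Ub) i i) := by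
      intro i _
      by_cases hi : lamVec Xb i = lamVec Xb 0
      · exact mul_nonneg (hnn i) (by linarith [hle i hi])
      · rw [hzero i hi, zero_mul]
    have hs : ∑ i, lamVec Yb i * (c - (Ubᵀ * H * Ub) i i) =
        c - ∑ i, lamVec Yb i * (Ubᵀ * H * Ub) i i := by
      simp only [mul_sub, Finset.sum_sub_distrib, ← Finset.sum_mul, hsum, one_mul]
    rw [← sub_eq_zero, ← hs, Finset.sum_eq_zero_iff_of_nonneg hnn2, hmu]
    constructor
    · rintro h i ⟨_, hi2⟩
      rcases mul_eq_zero.mp (h i (Finset.mem_univ _)) with h | h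
      · exact absurd h hi2.ne'
      · linarith
    · intro h i _
      rcases (hnn i).eq_or_lt with h0 | h0
      · rw [← h0, zero_mul]
      · have hi : lamVec Xb i = lamVec Xb 0 := by
          by_contra hc
          exact h0.ne' (hzero i hc)
        rw [h i ⟨hi, h0⟩, sub_self, mul_zero]
  refine ⟨hA, ?_, ?_⟩
  · intro H hH
    obtain ⟨i0, hi0⟩ : ∃ i, i ∈ mu := by
      by_contra hc
      push Not at hc
      have : ∑ i, lamVec Yb i = 0 := by
        refine Finset.sum_eq_zero fun i _ => ?_
        by_cases hi : lamVec Xb i = lamVec Xb 0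
        · by_contra h0
          exact hc i (by rw [hmu]; exact ⟨hi, lt_of_le_of_ne (hnn i) (Ne.symm h0)⟩)
        · exact hzero i hi
      linarith
    have hmua : ∀ i ∈ mu, lamVec Xb i = lamVec Xb 0 := by
      intro i hi; rw [hmu] at hi; exact hi.1
    have hmunu : ∀ i ∈ mu, ∀ j ∈ nu, i ≠ j := by
      rintro i hi j hj rfl
      rw [hmu] at hi; rw [hnu] at hj
      exact hi.2.ne' hj.2
    have hor : ∀ i, lamVec Xb i = lamVec Xb 0 → i ∉ mu → i ∈ nu := by
      intro i hi h
      rw [hmu] at h; rw [hnu]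
      refine ⟨hi, le_antisymm (not_lt.mp fun h0 => h ⟨hi, h0⟩) (hnn i)⟩
    have hsuff : ∀ (N : Matrix (Fin n) (Fin n) ℝ) (ρ : ℝ), N.IsSymm →
        (∀ i ∈ mu, ∀ j ∈ mu, (Ubᵀ * N * Ub) i j = if i = j then ρ else 0) →
        (∀ i ∈ mu, ∀ j ∈ nu, (Ubᵀ * N * Ub) i j = 0 ∧ (Ubᵀ * N * Ub) j i = 0) →
        (∀ q : Fin n → ℝ, (∀ i ∈ mu, q i = 0) → q ⬝ᵥ (Ubᵀ * N * Ub) *ᵥ q ≤ ρ * (q ⬝ᵥ q)) →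
        N ∈ {H' : Matrix (Fin n) (Fin n) ℝ |
          H'.IsSymm ∧ dirDeriv (fun X => lamVec X 0) Xb H' = mip Yb H'} := by
      intro N ρ hN h1 h2 h3
      refine ⟨hN, (hA N hN).mpr ?_⟩
      have ht := htop N hN
      set c := maxEig (Matrix.of fun z z' : {i : Fin n // lamVec Xb i = lamVec Xb 0} =>
            (Ubᵀ * N * Ub) z.1 z'.1)
      generalize Ubᵀ * N * Ub = M at *
      intro i hi
      have hρ : M i i = ρ := by rw [h1 i hi i hi, if_pos rfl]
      refine le_antisymm (isTop_diag_le ht ⟨i, hmua i hi⟩) ?_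
      rw [hρ]
      obtain ⟨a, ha0, ha1, ha2⟩ := block_ex _ M ht
      set p : Fin n → ℝ := fun i => if i ∈ mu then a i else 0 with hp
      set q : Fin n → ℝ := fun i => if i ∈ mu then 0 else a i with hq
      have hpq : a = p + q := by
        ext i; simp only [hp, hq, Pi.add_apply]; split_ifs <;> simp
      have haa : a ⬝ᵥ a = p ⬝ᵥ p + q ⬝ᵥ q := by
        simp only [dot_sq, ← Finset.sum_add_distrib]
        refine Finset.sum_congr rfl fun i _ => ?_
        simp only [hp, hq]; split_ifs <;> simp
      have hq0 : ∀ j, j ∉ nu → q j = 0 := by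
        intro j hj
        simp only [hq]
        split_ifs with h
        · rfl
        · exact ha0 j fun h' => hj (hor j h' h)
      have hp0 : ∀ j, j ∉ mu → p j = 0 := fun j hj => by simp [hp, hj]
      have e1 : p ⬝ᵥ M *ᵥ q = 0 := by
        simp only [dotProduct, mulVec, Finset.mul_sum]
        refine Finset.sum_eq_zero fun i _ => Finset.sum_eq_zero fun j _ => ?_
        by_cases hi : i ∈ mu
        · by_cases hj : j ∈ nu
          · rw [(h2 i hi j hj).1]; ring
          · rw [hq0 j hj]; ring
        · rw [hp0 i hi]; ring
      have e2 : q ⬝ᵥ M *ᵥ p = 0 := by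
        simp only [dotProduct, mulVec, Finset.mul_sum]
        refine Finset.sum_eq_zero fun j _ => Finset.sum_eq_zero fun i _ => ?_
        by_cases hi : i ∈ mu
        · by_cases hj : j ∈ nu
          · rw [(h2 i hi j hj).2]; ring
          · rw [hq0 j hj]; ring
        · rw [hp0 i hi]; ring
      have e3 : p ⬝ᵥ M *ᵥ p = ρ * (p ⬝ᵥ p) := by
        simp only [dotProduct, mulVec, Finset.mul_sum]
        refine Finset.sum_congr rfl fun i _ => ?_
        by_cases hi : i ∈ mu
        · rw [Finset.sum_eq_single i]
          · rw [h1 i hi i hi, if_pos rfl]; ring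
          · intro j _ hj
            by_cases hj' : j ∈ mu
            · rw [h1 i hi j hj', if_neg (Ne.symm hj)]; ring
            · rw [hp0 j hj']; ring
          · simp
        · rw [hp0 i hi]; simp
      have e4 := h3 q (fun i hi => by simp [hq, hi])
      rw [← ha2]
      have : ρ = ρ * (p ⬝ᵥ p) + ρ * (q ⬝ᵥ q) := by rw [← mul_add, ← haa, ha1, mul_one]
      rw [hpq, mulVec_add, add_dotProduct, dotProduct_add, dotProduct_add, e1, e2, e3]
      linarith
    constructor
    · intro hmem
      refine affineSpan_induction (p := fun H => ∃ ρ : ℝ,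
          (∀ i ∈ mu, ∀ j ∈ mu, (Ubᵀ * H * Ub) i j = if i = j then ρ else 0) ∧
          (∀ i ∈ mu, ∀ j ∈ nu, (Ubᵀ * H * Ub) i j = 0 ∧ (Ubᵀ * H * Ub) j i = 0)) hmem ?_ ?_
      · rintro N ⟨hN, hcrit⟩
        have hc := (hA N hN).mp hcrit
        have ht := htop N hN
        have hMs := symm_conj Ub hN
        set c := maxEig (Matrix.of fun z z' : {i : Fin n // lamVec Xb i = lamVec Xb 0} =>
            (Ubᵀ * N * Ub) z.1 z'.1)
        generalize Ubᵀ * N * Ub = M at *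
        have hoff : ∀ i ∈ mu, ∀ j, lamVec Xb j = lamVec Xb 0 → i ≠ j → M i j = 0 := by
          intro i hi j hj hij
          have hq : ∀ s : ℝ, 2 * s * M i j ≤ s ^ 2 * (c - M j j) := by
            intro s
            have := block_le _ M ht (Pi.single i 1 + Pi.single j s) (fun k hk => by
              have h1 : k ≠ i := fun h => hk (h ▸ hmua i hi)
              have h2 : k ≠ j := fun h => hk (h ▸ hj)
              simp [h1, h2])
            simp only [mulVec_add, add_dotProduct, dotProduct_add, single_dotProduct,
              mulVec_single, Pi.single_eq_same, Pi.single_eq_of_ne hij,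
              Pi.single_eq_of_ne hij.symm] at this
            simp [hc i hi, hMs.apply i j] at this
            nlinarith
          have hj' : 0 ≤ c - M j j := by
            have := isTop_diag_le ht ⟨j, hj⟩
            simpa using this
          have h1 := hq (M i j / (c - M j j + 1))
          have hpos : 0 < c - M j j + 1 := by linarith
          generalize c - M j j = w at *
          have h2 : 2 * (M i j / (w + 1)) * M i j = 2 * (M i j / (w + 1)) ^ 2 * (w + 1) := by
            field_simp
          rw [h2] at h1
          have h3 : (M i j / (w + 1)) ^ 2 = 0 := by
            nlinarith [sq_nonneg (M i j / (w + 1))]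
          have h4 := pow_eq_zero_iff (two_ne_zero) |>.mp h3
          rcases div_eq_zero_iff.mp h4 with h | h
          · exact h
          · linarith
        refine ⟨c, fun i hi j hj => ?_, fun i hi j hj => ?_⟩
        · split_ifs with h
          · rw [← h]; exact hc i hi
          · exact hoff i hi j (hmua j hj) h
        · have hj' : lamVec Xb j = lamVec Xb 0 := by rw [hnu] at hj; exact hj.1
          have := hoff i hi j hj' (hmunu i hi j hj)
          exact ⟨this, by rw [hMs.apply i j]; exact this⟩
      · rintro k A B C ⟨a, a1, a2⟩ ⟨b, b1, b2⟩ ⟨c, c1, c2⟩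
        have e : Ubᵀ * (k • (A -ᵥ B) +ᵥ C) * Ub =
            k • (Ubᵀ * A * Ub - Ubᵀ * B * Ub) + Ubᵀ * C * Ub := by
          simp [Matrix.mul_add, Matrix.add_mul, Matrix.mul_sub, Matrix.sub_mul]
        rw [e]
        refine ⟨k * (a - b) + c, fun i hi j hj => ?_, fun i hi j hj => ?_⟩
        · simp only [Matrix.add_apply, Matrix.smul_apply, Matrix.sub_apply, a1 i hi j hj,
            b1 i hi j hj, c1 i hi j hj, smul_eq_mul]
          split_ifs <;> simp
        · simp [Matrix.add_apply, Matrix.smul_apply, Matrix.sub_apply, a2 i hi j hj,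
            b2 i hi j hj, c2 i hi j hj]
    · rintro ⟨ρ, h1, h2⟩
      set d : Fin n → ℝ := fun i => if i ∈ mu then 1 else 0 with hdd
      set P := Ub * Matrix.diagonal d * Ubᵀ with hP
      have hPs : P.IsSymm := by
        rw [hP, Matrix.IsSymm, transpose_mul, transpose_mul, transpose_transpose,
          diagonal_transpose, Matrix.mul_assoc]
      have hPc : Ubᵀ * P * Ub = Matrix.diagonal d := conj_diag hU hP
      set K := ∑ i, ∑ j, |(Ubᵀ * H * Ub) i j| with hK
      have hgen : ∀ (e t : ℝ), e * K ≤ e * ρ + t → 0 ≤ e →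
          e • H + t • P ∈ {H' : Matrix (Fin n) (Fin n) ℝ |
          H'.IsSymm ∧ dirDeriv (fun X => lamVec X 0) Xb H' = mip Yb H'} := by
        intro e t het he
        have hc : Ubᵀ * (e • H + t • P) * Ub = e • (Ubᵀ * H * Ub) + t • Matrix.diagonal d := by
          rw [← hPc]; simp [Matrix.mul_add, Matrix.add_mul]
        apply hsuff _ (e * ρ + t) ((hH.smul e).add (hPs.smul t))
        · intro i hi j hj
          rw [hc]
          simp only [Matrix.add_apply, Matrix.smul_apply, smul_eq_mul, h1 i hi j hj,
            Matrix.diagonal_apply]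
          split_ifs <;> simp [hdd, hi]
        · intro i hi j hj
          have hij := hmunu i hi j hj
          rw [hc]
          simp [Matrix.add_apply, Matrix.smul_apply, h2 i hi j hj, Matrix.diagonal_apply_ne _ hij,
            Matrix.diagonal_apply_ne _ hij.symm]
        · intro q hq
          rw [hc, add_mulVec, dotProduct_add, smul_mulVec, smul_mulVec, dotProduct_smul,
            dotProduct_smul, diag_quad]
          have hz : ∑ i, d i * q i ^ 2 = 0 := by
            refine Finset.sum_eq_zero fun i _ => ?_
            by_cases hi : i ∈ mu
            · simp [hq i hi]
            · simp [hdd, hi]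
          have hb := bilin_bound (Ubᵀ * H * Ub) le_rfl one_pos q q
          rw [hz, smul_zero, add_zero, smul_eq_mul]
          have hQ : 0 ≤ q ⬝ᵥ q := by rw [dot_sq]; positivity
          have hb' : q ⬝ᵥ (Ubᵀ * H * Ub) *ᵥ q ≤ K * (q ⬝ᵥ q) := by
            rw [← hK] at hb; linarith
          calc _ ≤ e * (K * (q ⬝ᵥ q)) := mul_le_mul_of_nonneg_left hb' he
            _ = (e * K) * (q ⬝ᵥ q) := by ring
            _ ≤ _ := mul_le_mul_of_nonneg_right het hQ
      set t := max 0 (K - ρ) with ht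
      have m1 := subset_affineSpan ℝ _ (hgen 1 t (by linarith [le_max_right 0 (K - ρ)]) zero_le_one)
      have m2 := subset_affineSpan ℝ _ (hgen 0 t (by simp [ht]) le_rfl)
      have m3 := subset_affineSpan ℝ _ (hgen 0 0 (by simp) le_rfl)
      have := AffineSubspace.smul_vsub_vadd_mem _ (1 : ℝ) m1 m2 m3
      simpa using this
  · intro H hH
    have heq : Upsilon Xb Yb Ub H =
        -2 * ∑ i : Fin n, ∑ j : Fin n,
          (if i ∈ mu ∧ lamVec Xb j ≠ lamVec Xb 0 then
            lamVec Yb i / (lamVec Xb i - lamVec Xb j) * ((Ubᵀ * H * Ub) i j)^2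
          else 0) := by
      rw [upsilon_eq hH hU hd, neg_mul, ← mul_neg, ← Finset.sum_neg_distrib]
      congr 1
      refine Finset.sum_congr rfl fun i _ => ?_
      rw [← Finset.sum_neg_distrib, Finset.mul_sum]
      refine Finset.sum_congr rfl fun j _ => ?_
      by_cases hi : i ∈ mu
      · have hi' : lamVec Xb i = lamVec Xb 0 := by rw [hmu] at hi; exact hi.1
        by_cases hj : lamVec Xb j = lamVec Xb 0
        · simp [hj, hi']
        · rw [if_pos ⟨hi, hj⟩, hi', ← neg_sub (lamVec Xb 0), inv_neg, div_eq_mul_inv]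
          ring
      · rw [if_neg (fun h => hi h.1)]
        have : lamVec Yb i = 0 := by
          by_cases hx : lamVec Xb i = lamVec Xb 0
          · by_contra h0
            exact hi (by rw [hmu]; exact ⟨hx, lt_of_le_of_ne (hnn i) (Ne.symm h0)⟩)
          · exact hzero i hx
        rw [this]; simp
    refine ⟨heq, ?_⟩
    rw [heq]
    have : 0 ≤ ∑ i : Fin n, ∑ j : Fin n,
          (if i ∈ mu ∧ lamVec Xb j ≠ lamVec Xb 0 then
            lamVec Yb i / (lamVec Xb i - lamVec Xb j) * ((Ubᵀ * H * Ub) i j)^2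
          else 0) := by
      refine Finset.sum_nonneg fun i _ => Finset.sum_nonneg fun j _ => ?_
      split_ifs with h
      · obtain ⟨hi, hj⟩ := h
        rw [hmu] at hi
        have : 0 ≤ lamVec Xb i - lamVec Xb j := by rw [hi.1]; linarith [hl j]
        exact mul_nonneg (div_nonneg (hnn i) this) (sq_nonneg _)
      · exact le_rfl
    linarith

end
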